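/- There exist functions j₊, j₋ : (0,∞) × [1,∞) → ℂ (arguments (ν, r)), infinitely differentiable in r, such that: (i) J_ν(r) = r^{-1/2} ( e^{ir} j₊(ν,r) + e^{-ir} j₋(ν,r) ) for all ν > 0 and r ≥ 1; (ii) for each fixed ν > 0 and each N ∈ ℕ there is C_{ν,N} with |(∂/∂r)^N j_±(ν,r)| ≤ C_{ν,N} r^{-N-1} for N ≥ 1 and |j_±(ν,r)| ≤ C_{ν,0}, for all r ≥ 1; and (iii) for every N ∈ ℕ there exists a constant C_N independent of ν such that |(∂/∂r)^N j_±(ν,r)| ≤ C_N · 2^ν · (ν/r)^N whenever r ≥ 2ν and 2ν ≥ 1 (with (ν/r)^0 interpreted as 1). -/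

import Mathlib

open MeasureTheory

/-- The Bessel function of order `ν`, defined for `ν > -1/2` and `r > 0` by the
Poisson integral representation
`J_ν(r) = (r/2)^ν / (Γ(ν+1/2)Γ(1/2)) ∫_{-1}^{1} e^{isr} (1-s²)^{ν-1/2} ds`. -/
noncomputable def besselJ (ν r : ℝ) : ℂ :=
  (((r / 2) ^ ν / (Real.Gamma (ν + 1 / 2) * Real.Gamma (1 / 2)) : ℝ) : ℂ) *
    ∫ s in (-1 : ℝ)..1,
      Complex.exp (Complex.I * (s : ℂ) * (r : ℂ)) * (((1 - s ^ 2) ^ (ν - 1 / 2) : ℝ) : ℂ)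


namespace BesselAux

open Complex Set Filter Topology

/-- The base of the power in the Hankel-type integral. -/
noncomputable def bW (t : ℝ) (z : ℂ) : ℂ := 1 + I * t / (2 * z)

/-- Hankel-type integral. -/
noncomputable def bF (a : ℝ) (z : ℂ) : ℂ :=
  ∫ t in Ioi (0 : ℝ), ((Real.exp (-t) * t ^ a : ℝ) : ℂ) * (bW t z) ^ (a : ℂ)

/-- A sector around the positive axis. -/
def bS : Set ℂ := {z | ‖z‖ < 2 * z.re}

lemma bS_open : IsOpen bS := isOpen_lt continuous_norm (continuous_const.mul continuous_re)

lemma bS_re {z : ℂ} (hz : z ∈ bS) : 0 < z.re := by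
  have : ‖z‖ < 2 * z.re := hz
  linarith [norm_nonneg z]

lemma bS_ne {z : ℂ} (hz : z ∈ bS) : z ≠ 0 := by
  rintro rfl
  exact absurd (bS_re hz) (by simp)

lemma bW_eq (t : ℝ) {z : ℂ} (hz : z ∈ bS) : bW t z * z = z + I * t / 2 := by
  have := bS_ne hz
  unfold bW; field_simp

lemma bW_slit (t : ℝ) {z : ℂ} (hz : z ∈ bS) : bW t z ∈ slitPlane := by
  have h := bW_eq t hz
  rw [mem_slitPlane_iff]
  by_contra hc
  push Not at hc
  have h2 := congrArg re h
  simp [hc.2] at h2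
  nlinarith [bS_re hz]

lemma bW_norm_ge (t : ℝ) {z : ℂ} (hz : z ∈ bS) : 1 / 2 ≤ ‖bW t z‖ := by
  have h := bW_eq t hz
  have h1 : ‖z‖ < 2 * z.re := hz
  have h2 : z.re ≤ ‖bW t z * z‖ := by
    rw [h]
    refine le_trans ?_ (re_le_norm _)
    simp
  rw [norm_mul] at h2
  have h3 : 0 < ‖z‖ := norm_pos_iff.2 (bS_ne hz)
  by_contra hc
  push Not at hc
  nlinarith

lemma bW_norm_le {t : ℝ} (ht : 0 ≤ t) (z : ℂ) {m : ℝ} (hm : 0 < m) (hz : m ≤ ‖z‖) :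
    ‖bW t z‖ ≤ 1 + t / (2 * m) := by
  unfold bW
  refine (norm_add_le _ _).trans ?_
  simp only [norm_one, norm_div, norm_mul, norm_I, one_mul, norm_real, Real.norm_of_nonneg ht,
    Complex.norm_ofNat]
  gcongr

lemma rpow_two_sided {q B b : ℝ} (h1 : 1 / 2 ≤ q) (h2 : q ≤ B) (hB : 1 ≤ B) :
    q ^ b ≤ (2 * B) ^ |b| := by
  rcases le_total 0 b with hb | hb
  · rw [abs_of_nonneg hb]
    exact Real.rpow_le_rpow (by linarith) (by linarith) hb
  · rw [abs_of_nonpos hb]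
    calc q ^ b ≤ (1/2) ^ b := Real.rpow_le_rpow_of_nonpos (by norm_num) h1 hb
      _ = 2 ^ (-b) := by rw [one_div, Real.inv_rpow (by norm_num), Real.rpow_neg (by norm_num)]
      _ ≤ (2 * B) ^ (-b) := Real.rpow_le_rpow (by norm_num) (by linarith) (by linarith)

lemma rpow_exp_bound {c m : ℝ} (hc : 0 ≤ c) (hm : 0 < m) :
    ∃ K : ℝ, 0 < K ∧ ∀ t : ℝ, 0 ≤ t → (2 * (1 + t / (2 * m))) ^ c ≤ K * Real.exp (t / 2) := by
  set k : ℝ := 2 * c + 1 with hk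
  have hk0 : 0 < k := by positivity
  set M : ℝ := 1 + k / (2 * m) with hM
  have hM0 : 0 < M := by positivity
  refine ⟨(2 * M) ^ c, by positivity, fun t ht => ?_⟩
  have h1 : 1 + t / (2 * m) ≤ M * Real.exp (t / k) := by
    have h2 : 1 + t / k ≤ Real.exp (t / k) := by linarith [Real.add_one_le_exp (t / k)]
    have h3 : 1 + t / (2 * m) ≤ M * (1 + t / k) := by
      have : M * (1 + t / k) = 1 + t / (2 * m) + t / k + k / (2 * m) := by
        rw [hM]; field_simp; ring
      rw [this]
      have : 0 ≤ t / k + k / (2 * m) := by positivity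
      linarith
    exact h3.trans (by gcongr)
  calc (2 * (1 + t / (2 * m))) ^ c ≤ ((2 * M) * Real.exp (t / k)) ^ c :=
        Real.rpow_le_rpow (by positivity) (by nlinarith) hc
    _ = (2 * M) ^ c * Real.exp (t / k * c) := by
        rw [Real.mul_rpow (by positivity) (by positivity), ← Real.exp_mul]
    _ ≤ (2 * M) ^ c * Real.exp (t / 2) := by
        gcongr
        rw [div_mul_eq_mul_div, div_le_div_iff₀ hk0 (by norm_num)]
        nlinarith

lemma bW_pow_bound (b : ℝ) {m : ℝ} (hm : 0 < m) :
    ∃ K : ℝ, 0 < K ∧ ∀ z ∈ bS, m ≤ ‖z‖ → ∀ t : ℝ, 0 ≤ t →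
      ‖(bW t z) ^ (b : ℂ)‖ ≤ K * Real.exp (t / 2) := by
  obtain ⟨K, hK, h⟩ := rpow_exp_bound (abs_nonneg b) hm
  refine ⟨K, hK, fun z hz hmz t ht => ?_⟩
  rw [norm_cpow_real]
  refine (rpow_two_sided (bW_norm_ge t hz) (bW_norm_le ht z hm hmz) ?_).trans (h t ht)
  have : 0 ≤ t / (2 * m) := by positivity
  linarith

lemma gamma_int {s b : ℝ} (hs : -1 < s) (hb : 0 < b) :
    IntegrableOn (fun t : ℝ => t ^ s * Real.exp (-b * t)) (Ioi 0) := by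
  have := integrableOn_rpow_mul_exp_neg_mul_rpow hs one_pos hb
  simpa using this

lemma bW_cont (z : ℂ) : Continuous (fun t : ℝ => bW t z) := by
  unfold bW
  fun_prop

lemma bF_meas (a b : ℝ) {z : ℂ} (hz : z ∈ bS) :
    ContinuousOn (fun t : ℝ => ((Real.exp (-t) * t ^ a : ℝ) : ℂ) * (bW t z) ^ (b : ℂ)) (Ioi 0) := by
  refine ContinuousOn.mul ?_ ?_
  · refine continuous_ofReal.comp_continuousOn (ContinuousOn.mul (by fun_prop) ?_)
    intro t ht
    exact (Real.continuousAt_rpow_const t a (Or.inl (ne_of_gt ht))).continuousWithinAt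
  · intro t _
    exact ((bW_cont z).continuousAt.cpow continuousAt_const (bW_slit t hz)).continuousWithinAt

lemma integrand_bound {a b K t : ℝ} {z : ℂ} (ht : 0 < t)
    (h : ‖(bW t z) ^ (b : ℂ)‖ ≤ K * Real.exp (t / 2)) :
    ‖((Real.exp (-t) * t ^ a : ℝ) : ℂ) * (bW t z) ^ (b : ℂ)‖ ≤
      K * (t ^ a * Real.exp (-(1 / 2) * t)) := by
  have h0 : 0 ≤ Real.exp (-t) * t ^ a := by positivity
  rw [norm_mul, norm_real, Real.norm_of_nonneg h0]
  calc _ ≤ (Real.exp (-t) * t ^ a) * (K * Real.exp (t / 2)) := by gcongr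
    _ = K * (t ^ a * (Real.exp (-t) * Real.exp (t / 2))) := by ring
    _ = _ := by rw [← Real.exp_add]; ring_nf

lemma bF_integrable {a : ℝ} (b : ℝ) (ha : -1 < a) {z : ℂ} (hz : z ∈ bS) :
    IntegrableOn (fun t : ℝ => ((Real.exp (-t) * t ^ a : ℝ) : ℂ) * (bW t z) ^ (b : ℂ)) (Ioi 0) := by
  obtain ⟨K, hK, h⟩ := bW_pow_bound b (norm_pos_iff.2 (bS_ne hz))
  refine Integrable.mono' ((gamma_int ha (b := 1 / 2) (by norm_num)).const_mul K)
    ((bF_meas a b hz).aestronglyMeasurable measurableSet_Ioi) ?_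
  filter_upwards [ae_restrict_mem measurableSet_Ioi] with t ht
  exact integrand_bound ht (h z hz le_rfl t (le_of_lt ht))

lemma bF_norm_le {a : ℝ} (b : ℝ) (ha : -1 < a) {m : ℝ} (hm : 0 < m) :
    ∃ C : ℝ, 0 < C ∧ ∀ z ∈ bS, m ≤ ‖z‖ →
      ‖∫ t in Ioi (0 : ℝ), ((Real.exp (-t) * t ^ a : ℝ) : ℂ) * (bW t z) ^ (b : ℂ)‖ ≤ C := by
  obtain ⟨K, hK, h⟩ := bW_pow_bound b hm
  refine ⟨|∫ t in Ioi (0 : ℝ), K * (t ^ a * Real.exp (-(1 / 2) * t))| + 1, by positivity,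
    fun z hz hmz => ?_⟩
  refine le_trans ?_ (le_trans (le_abs_self _) (by linarith))
  refine norm_integral_le_of_norm_le ((gamma_int ha (b := 1 / 2) (by norm_num)).const_mul K) ?_
  filter_upwards [ae_restrict_mem measurableSet_Ioi] with t ht
  exact integrand_bound ht (h z hz hmz t (le_of_lt ht))

lemma bW_deriv (t : ℝ) {z : ℂ} (hz : z ∈ bS) :
    HasDerivAt (fun z => bW t z) (-(I * t / (2 * z ^ 2))) z := by
  have h0 := bS_ne hz
  have h := ((hasDerivAt_inv h0).const_mul (I * t / 2)).const_add 1
  have e : (fun z => bW t z) = fun z => 1 + I * t / 2 * z⁻¹ := by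
    funext w; unfold bW; rw [div_mul_eq_div_div, div_eq_mul_inv _ w]
  rw [e]
  convert! h using 1
  field_simp

lemma bF_hasDerivAt {a : ℝ} (ha : -1 < a) {z : ℂ} (hz : z ∈ bS) :
    HasDerivAt (bF a) (-(a * I / (2 * z ^ 2)) *
      ∫ t in Ioi (0 : ℝ), ((Real.exp (-t) * t ^ (a + 1) : ℝ) : ℂ) * (bW t z) ^ ((a - 1 : ℝ) : ℂ)) z := by
  have h0 : 0 < ‖z‖ := norm_pos_iff.2 (bS_ne hz)
  set m := ‖z‖ / 2 with hm
  have hm0 : 0 < m := by positivity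
  obtain ⟨K, hK, h⟩ := bW_pow_bound (a - 1) hm0
  have hs : bS ∩ {w | m < ‖w‖} ∈ 𝓝 z :=
    (bS_open.inter (isOpen_lt continuous_const continuous_norm)).mem_nhds
      ⟨hz, by show m < ‖z‖; rw [hm]; linarith⟩
  have key := hasDerivAt_integral_of_dominated_loc_of_deriv_le (μ := volume.restrict (Ioi (0:ℝ)))
    (F := fun z t => ((Real.exp (-t) * t ^ a : ℝ) : ℂ) * (bW t z) ^ (a : ℂ))
    (F' := fun z t => -(a * I / (2 * z ^ 2)) *
      (((Real.exp (-t) * t ^ (a + 1) : ℝ) : ℂ) * (bW t z) ^ ((a - 1 : ℝ) : ℂ)))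
    (bound := fun t => |a| / (2 * m ^ 2) * (K * (t ^ (a + 1) * Real.exp (-(1 / 2) * t))))
    hs ?_ (bF_integrable a ha hz) ?_ ?_ ?_ ?_
  · have := key.2
    rw [integral_const_mul] at this
    exact this
  · filter_upwards [bS_open.mem_nhds hz] with w hw
    exact (bF_meas a a hw).aestronglyMeasurable measurableSet_Ioi
  · exact ((bF_meas (a + 1) (a - 1) hz).aestronglyMeasurable measurableSet_Ioi).const_mul _
  · filter_upwards [ae_restrict_mem measurableSet_Ioi] with t ht w hw
    rw [norm_mul]
    refine mul_le_mul ?_ (integrand_bound ht (h w hw.1 (le_of_lt hw.2) t (le_of_lt ht)))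
      (norm_nonneg _) (by positivity)
    have : m < ‖w‖ := hw.2
    simp only [norm_neg, norm_div, norm_mul, norm_I, mul_one, norm_real, norm_pow,
      Complex.norm_ofNat, Real.norm_eq_abs]
    gcongr
  · exact ((gamma_int (by linarith) (by norm_num)).const_mul K).const_mul _
  · filter_upwards [ae_restrict_mem measurableSet_Ioi] with t ht w hw
    have hd := ((bW_deriv t hw.1).cpow_const (c := (a : ℂ)) (bW_slit t hw.1)).const_mul
      ((Real.exp (-t) * t ^ a : ℝ) : ℂ)
    convert! hd using 1
    rw [Real.rpow_add_one (ne_of_gt ht)]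
    push_cast
    ring

lemma bF_diff {a : ℝ} (ha : -1 < a) : DifferentiableOn ℂ (bF a) bS := fun _ hz =>
  (bF_hasDerivAt ha hz).differentiableAt.differentiableWithinAt

lemma bF_deriv_bound {a : ℝ} (ha : -1 < a) {m : ℝ} (hm : 0 < m) :
    ∃ C : ℝ, 0 < C ∧ ∀ z ∈ bS, m ≤ ‖z‖ → ‖deriv (bF a) z‖ ≤ C / ‖z‖ ^ 2 := by
  obtain ⟨C, hC, h⟩ := bF_norm_le (a := a + 1) (a - 1) (by linarith) hm
  refine ⟨(|a| / 2 + 1) * C, by positivity, fun z hz hmz => ?_⟩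
  rw [(bF_hasDerivAt ha hz).deriv, norm_mul]
  have h1 := h z hz hmz
  have h0 : 0 < ‖z‖ := norm_pos_iff.2 (bS_ne hz)
  have h2 : ‖-(a * I / (2 * z ^ 2))‖ ≤ (|a| / 2 + 1) / ‖z‖ ^ 2 := by
    simp only [norm_neg, norm_div, norm_mul, norm_I, mul_one, norm_real, norm_pow,
      Complex.norm_ofNat, Real.norm_eq_abs]
    rw [div_mul_eq_div_div]
    gcongr
    linarith
  calc _ ≤ (|a| / 2 + 1) / ‖z‖ ^ 2 * C := by gcongr
    _ = _ := by ring

lemma ball_geom {r : ℝ} (hr : 0 < r) {z : ℂ} (hz : z ∈ Metric.closedBall (r : ℂ) (r / 4)) :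
    z ∈ bS ∧ 3 / 4 * r ≤ ‖z‖ := by
  rw [mem_closedBall_iff_norm] at hz
  have h1 : |(z - r).re| ≤ r / 4 := (abs_re_le_norm _).trans hz
  simp only [sub_re, ofReal_re] at h1
  have h2 := abs_le.1 h1
  have h3 : ‖z‖ ≤ r / 4 + r := by
    have : ‖z‖ ≤ ‖z - r‖ + ‖(r : ℂ)‖ := by simpa using norm_add_le (z - r) (r : ℂ)
    rw [norm_real, Real.norm_of_nonneg hr.le] at this
    linarith
  refine ⟨?_, ?_⟩
  · show ‖z‖ < 2 * z.re
    linarith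
  · exact le_trans (by linarith) (re_le_norm z)

lemma real_mem_bS {r : ℝ} (hr : 0 < r) : (r : ℂ) ∈ bS :=
  (ball_geom hr (Metric.mem_closedBall_self (by positivity))).1

lemma cauchy_est {G : ℂ → ℂ} (hG : DifferentiableOn ℂ G bS) (n : ℕ) {r C : ℝ} (hr : 0 < r)
    (hC : ∀ z ∈ bS, 3 / 4 * r ≤ ‖z‖ → ‖G z‖ ≤ C) :
    ‖iteratedDeriv n G r‖ ≤ n.factorial * 4 ^ n * C / r ^ n := by
  have h := norm_iteratedDeriv_le_of_forall_mem_sphere_norm_le (c := (r : ℂ)) (R := r / 4) (C := C)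
    (f := G) n (by positivity) ?_ ?_
  · refine h.trans (le_of_eq ?_)
    rw [div_pow]
    field_simp
  · refine DifferentiableOn.diffContOnCl ?_
    refine hG.mono ?_
    refine Metric.closure_ball_subset_closedBall.trans ?_
    exact fun z hz => (ball_geom hr hz).1
  · intro z hz
    have := ball_geom hr (Metric.sphere_subset_closedBall hz)
    exact hC z this.1 this.2

lemma iter_eq {G : ℂ → ℂ} (hG : DifferentiableOn ℂ G bS) (n : ℕ) :
    ∀ r ∈ Ici (1 : ℝ), iteratedDerivWithin n (fun x : ℝ => G x) (Ici 1) r = iteratedDeriv n G r := by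
  induction n with
  | zero => intro r _; simp
  | succ n ih =>
    intro r hr
    have hr' : (1 : ℝ) ≤ r := hr
    rw [iteratedDerivWithin_succ, iteratedDeriv_succ]
    rw [derivWithin_congr (f := fun x : ℝ => iteratedDeriv n G x) ih (ih r hr)]
    have hA : AnalyticAt ℂ G r := hG.analyticAt (bS_open.mem_nhds (real_mem_bS (by linarith)))
    have hB : DifferentiableAt ℂ (iteratedDeriv n G) r := by
      rw [iteratedDeriv_eq_iterate]
      exact (hA.iterated_deriv n).differentiableAt
    exact (hB.hasDerivAt.comp_ofReal.hasDerivWithinAt).derivWithin (uniqueDiffOn_Ici 1 r hr)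

lemma smooth {G : ℂ → ℂ} (hG : DifferentiableOn ℂ G bS) :
    ContDiffOn ℝ (⊤ : ℕ∞) (fun x : ℝ => G x) (Ici 1) := by
  have h1 : ContDiffOn ℂ (⊤ : ℕ∞) G bS := hG.contDiffOn bS_open
  have h2 : ContDiffOn ℝ (⊤ : ℕ∞) G bS := h1.restrict_scalars ℝ
  refine h2.comp (g := G) (f := fun x : ℝ => (x : ℂ)) ofRealCLM.contDiff.contDiffOn ?_
  intro x hx
  exact real_mem_bS (lt_of_lt_of_le one_pos hx)

lemma bF_uniform {ν : ℝ} (hν : 1 ≤ 2 * ν) {z : ℂ} (h : 3 / 4 * (2 * ν) ≤ ‖z‖) :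
    ‖bF (ν - 1 / 2) z‖ ≤ Real.Gamma (ν + 1 / 2) * (3 / 2) ^ (ν + 1 / 2) := by
  have hν0 : 0 < ν := by linarith
  have hI : ∫ t in Ioi (0 : ℝ), t ^ (ν - 1 / 2) * Real.exp (-(2 / 3) * t) =
      Real.Gamma (ν + 1 / 2) * (3 / 2) ^ (ν + 1 / 2) := by
    have := Real.integral_rpow_mul_exp_neg_mul_Ioi (a := ν + 1 / 2) (r := 2 / 3)
      (by linarith) (by norm_num)
    rw [show ν + 1 / 2 - 1 = ν - 1 / 2 by ring] at this
    simp only [neg_mul]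
    rw [this]
    norm_num
    ring
  rw [← hI]
  refine norm_integral_le_of_norm_le (gamma_int (by linarith) (by norm_num)) ?_
  filter_upwards [ae_restrict_mem measurableSet_Ioi] with t ht
  have ht0 : 0 < t := ht
  have h0 : 0 ≤ Real.exp (-t) * t ^ (ν - 1 / 2) := by positivity
  rw [norm_mul, norm_real, Real.norm_of_nonneg h0, norm_cpow_real]
  have h1 : ‖bW t z‖ ≤ Real.exp (t / (3 * ν)) := by
    refine (bW_norm_le ht0.le z (by linarith) h).trans ?_
    rw [show 2 * (3 / 4 * (2 * ν)) = 3 * ν by ring]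
    linarith [Real.add_one_le_exp (t / (3 * ν))]
  have h2 : ‖bW t z‖ ^ (ν - 1 / 2) ≤ Real.exp (t / 3) := by
    refine (Real.rpow_le_rpow (norm_nonneg _) h1 (by linarith)).trans ?_
    rw [← Real.exp_mul]
    gcongr
    rw [div_mul_eq_mul_div, div_le_div_iff₀ (by positivity) (by norm_num)]
    nlinarith
  calc _ ≤ (Real.exp (-t) * t ^ (ν - 1 / 2)) * Real.exp (t / 3) := by gcongr
    _ = t ^ (ν - 1 / 2) * (Real.exp (-t) * Real.exp (t / 3)) := by ring
    _ = _ := by rw [← Real.exp_add]; ring_nf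

/-- The complex integrand of the Poisson integral. -/
noncomputable def bf (r a : ℝ) (z : ℂ) : ℂ := exp (I * z * r) * (1 - z ^ 2) ^ (a : ℂ)

lemma one_sub_sq_re (s y : ℝ) : (1 - ((s : ℂ) + y * I) ^ 2).re = 1 - s ^ 2 + y ^ 2 := by
  simp [pow_two]; ring

lemma sq_slit {s y : ℝ} (h : 0 < 1 - s ^ 2 + y ^ 2) :
    1 - ((s : ℂ) + y * I) ^ 2 ∈ slitPlane := by
  rw [mem_slitPlane_iff]; left; rw [one_sub_sq_re]; exact h

lemma bf_norm (r a s y : ℝ) : ‖bf r a (s + y * I)‖ =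
    Real.exp (-(r * y)) * ‖1 - ((s : ℂ) + y * I) ^ 2‖ ^ a := by
  unfold bf
  rw [norm_mul, norm_cpow_real, norm_exp]
  congr 2
  simp; ring

lemma q_ge (s y : ℝ) : 1 - s ^ 2 + y ^ 2 ≤ ‖1 - ((s : ℂ) + y * I) ^ 2‖ := by
  rw [← one_sub_sq_re]; exact re_le_norm _

lemma q_le {s y : ℝ} (hs : s ^ 2 ≤ 1) : ‖1 - ((s : ℂ) + y * I) ^ 2‖ ≤ 2 + y ^ 2 := by
  refine (norm_sub_le _ _).trans ?_
  rw [norm_pow, norm_one, ← normSq_eq_norm_sq, normSq_add_mul_I]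
  linarith

lemma bf_diff {r a : ℝ} {s y : ℝ} (h : 0 < 1 - s ^ 2 + y ^ 2) :
    DifferentiableAt ℂ (bf r a) (s + y * I) := by
  unfold bf
  refine DifferentiableAt.mul (by fun_prop) ?_
  exact DifferentiableAt.cpow (by fun_prop) (by fun_prop) (sq_slit h)

lemma vert_tendsto {g : ℝ → ℂ} (hg : IntegrableOn g (Ioi 0)) :
    Tendsto (fun n : ℕ => ∫ x in (1 / ((n : ℝ) + 1))..((n : ℝ) + 1), g x) atTop
      (𝓝 (∫ x in Ioi (0 : ℝ), g x)) := by
  have hH : Tendsto (fun n : ℕ => (n : ℝ) + 1) atTop atTop :=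
    tendsto_atTop_add_const_right _ _ tendsto_natCast_atTop_atTop
  have h1 := intervalIntegral_tendsto_integral_Ioi 0 hg hH
  have hii : ∀ c : ℝ, 0 ≤ c → IntervalIntegrable g volume 0 c := fun c hc => by
    rw [intervalIntegrable_iff_integrableOn_Ioc_of_le hc]
    exact hg.mono_set Ioc_subset_Ioi_self
  have h2 : Tendsto (fun n : ℕ => ∫ x in (0 : ℝ)..(1 / ((n : ℝ) + 1)), g x) atTop (𝓝 0) := by
    have hc := intervalIntegral.continuousOn_primitive_interval' (hii 1 zero_le_one)
      (left_mem_uIcc) 0 left_mem_uIcc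
    have ht : Tendsto (fun n : ℕ => 1 / ((n : ℝ) + 1)) atTop (𝓝[uIcc 0 1] 0) := by
      refine tendsto_nhdsWithin_iff.2 ⟨tendsto_one_div_add_atTop_nhds_zero_nat, ?_⟩
      refine Eventually.of_forall fun n => ?_
      rw [uIcc_of_le zero_le_one]
      refine ⟨by positivity, ?_⟩
      rw [div_le_one (by positivity)]
      have : (0 : ℝ) ≤ n := n.cast_nonneg
      linarith
    have := hc.tendsto.comp ht
    simpa [Function.comp_def] using this
  have h3 := h1.sub h2
  rw [sub_zero] at h3
  refine h3.congr fun n => ?_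
  exact intervalIntegral.integral_interval_sub_left (hii _ (by positivity)) (hii _ (by positivity))

lemma top_tendsto {r a : ℝ} (hr : 0 < r) :
    Tendsto (fun y : ℝ => ∫ s in (-1 : ℝ)..1, bf r a (s + y * I)) atTop (𝓝 0) := by
  have ht : Tendsto (fun y : ℝ => 2 * (Real.exp (2 * r) *
      ((2 + y) ^ (2 * |a|) * Real.exp (-r * (2 + y))))) atTop (𝓝 0) := by
    have h := (tendsto_rpow_mul_exp_neg_mul_atTop_nhds_zero (2 * |a|) r hr).comp
      (tendsto_atTop_add_const_left atTop 2 tendsto_id)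
    simpa using (h.const_mul (Real.exp (2 * r))).const_mul 2
  refine squeeze_zero_norm' ?_ ht
  filter_upwards [eventually_ge_atTop (1 : ℝ)] with y hy
  have := intervalIntegral.norm_integral_le_of_norm_le_const (a := (-1 : ℝ)) (b := 1)
    (f := fun s : ℝ => bf r a (s + y * I))
    (C := Real.exp (2 * r) * ((2 + y) ^ (2 * |a|) * Real.exp (-r * (2 + y)))) ?_
  · refine this.trans (le_of_eq ?_)
    norm_num
    ring
  · intro s hs
    rw [uIoc_of_le (by norm_num)] at hs
    have hs2 : s ^ 2 ≤ 1 := by nlinarith [hs.1, hs.2]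
    rw [bf_norm]
    have hq1 : 1 ≤ ‖1 - ((s : ℂ) + y * I) ^ 2‖ := le_trans (by nlinarith) (q_ge s y)
    have hq2 : ‖1 - ((s : ℂ) + y * I) ^ 2‖ ≤ (2 + y) ^ (2 : ℝ) :=
      (q_le hs2).trans (by rw [Real.rpow_two]; nlinarith)
    have hq3 : ‖1 - ((s : ℂ) + y * I) ^ 2‖ ^ a ≤ (2 + y) ^ (2 * |a|) := by
      rw [Real.rpow_mul (by linarith)]
      exact (Real.rpow_le_rpow_of_exponent_le hq1 (le_abs_self a)).trans
        (Real.rpow_le_rpow (norm_nonneg _) hq2 (abs_nonneg a))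
    calc _ ≤ Real.exp (-(r * y)) * (2 + y) ^ (2 * |a|) := by gcongr
      _ = (Real.exp (2 * r) * Real.exp (-r * (2 + y))) * (2 + y) ^ (2 * |a|) := by
          rw [← Real.exp_add]; ring_nf
      _ = _ := by ring

lemma bot_tendsto {r a : ℝ} (hr : 0 < r) (ha : -1 < a) :
    Tendsto (fun y : ℝ => ∫ s in (-1 : ℝ)..1, bf r a (s + y * I)) (𝓝[>] 0)
      (𝓝 (∫ s in (-1 : ℝ)..1, bf r a s)) := by
  have hne : ∀ᵐ s : ℝ ∂volume, s ≠ 1 := by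
    simp [ae_iff]
  refine intervalIntegral.tendsto_integral_filter_of_dominated_convergence
    (fun s => (1 - s) ^ a + (1 + s) ^ a + 3 ^ |a|) ?_ ?_ ?_ ?_
  · filter_upwards [self_mem_nhdsWithin] with y hy
    have hy0 : (0 : ℝ) < y := hy
    refine ContinuousOn.aestronglyMeasurable ?_ measurableSet_uIoc
    intro s hs
    rw [uIoc_of_le (by norm_num)] at hs
    have hpos : 0 < 1 - s ^ 2 + y ^ 2 := by nlinarith [hs.1, hs.2, mul_pos hy0 hy0]
    refine (ContinuousAt.comp (g := bf r a) (f := fun s : ℝ => (s : ℂ) + y * I)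
      (bf_diff hpos).continuousAt ?_).continuousWithinAt
    fun_prop
  · have h1 : ∀ᶠ y : ℝ in 𝓝[>] 0, y < 1 := nhdsWithin_le_nhds (Iio_mem_nhds one_pos)
    filter_upwards [self_mem_nhdsWithin, h1] with y hy hy1
    have hy0 : (0 : ℝ) < y := hy
    filter_upwards [hne] with s hs1 hs
    rw [uIoc_of_le (by norm_num)] at hs
    have hs2 : s < 1 := lt_of_le_of_ne hs.2 hs1
    have hs3 : -1 < s := hs.1
    rw [bf_norm]
    have hq1 := q_ge s y
    have hq2 : ‖1 - ((s : ℂ) + y * I) ^ 2‖ ≤ 3 := (q_le (by nlinarith)).trans (by nlinarith)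
    have he : Real.exp (-(r * y)) ≤ 1 := Real.exp_le_one_iff.2 (by nlinarith)
    have hp1 : 0 ≤ (1 - s) ^ a := Real.rpow_nonneg (by linarith) _
    have hp2 : 0 ≤ (1 + s) ^ a := Real.rpow_nonneg (by linarith) _
    have hp3 : (0 : ℝ) ≤ 3 ^ |a| := by positivity
    have hq3 : ‖1 - ((s : ℂ) + y * I) ^ 2‖ ^ a ≤ (1 - s) ^ a + (1 + s) ^ a + 3 ^ |a| := by
      rcases le_total 0 a with h | h
      · have := Real.rpow_le_rpow (norm_nonneg _) hq2 h
        rw [abs_of_nonneg h] at hp3 ⊢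
        linarith
      · rcases le_total 0 s with h' | h'
        · have := Real.rpow_le_rpow_of_nonpos (x := 1 - s)
            (y := ‖1 - ((s : ℂ) + y * I) ^ 2‖) (by linarith) (by nlinarith) h
          linarith
        · have := Real.rpow_le_rpow_of_nonpos (x := 1 + s)
            (y := ‖1 - ((s : ℂ) + y * I) ^ 2‖) (by linarith) (by nlinarith) h
          linarith
    calc _ ≤ 1 * ‖1 - ((s : ℂ) + y * I) ^ 2‖ ^ a := by gcongr
      _ ≤ _ := by rw [one_mul]; exact hq3
  · have h1 : IntervalIntegrable (fun s : ℝ => (1 - s) ^ a) volume (-1) 1 := by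
      have := (intervalIntegral.intervalIntegrable_rpow' (a := 2) (b := 0) ha).comp_sub_left 1
      norm_num at this
      exact this
    have h2 : IntervalIntegrable (fun s : ℝ => (1 + s) ^ a) volume (-1) 1 := by
      have := (intervalIntegral.intervalIntegrable_rpow' (a := 0) (b := 2) ha).comp_add_left 1
      norm_num at this
      exact this
    exact (h1.add h2).add intervalIntegrable_const
  · filter_upwards [hne] with s hs1 hs
    rw [uIoc_of_le (by norm_num)] at hs
    have hs2 : s < 1 := lt_of_le_of_ne hs.2 hs1
    have hpos : 0 < 1 - s ^ 2 + (0 : ℝ) ^ 2 := by nlinarith [hs.1]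
    have hc : ContinuousAt (fun y : ℝ => bf r a (s + y * I)) 0 :=
      ContinuousAt.comp (g := bf r a) (f := fun y : ℝ => (s : ℂ) + y * I)
        (bf_diff hpos).continuousAt (by fun_prop)
    have := hc.tendsto.mono_left (nhdsWithin_le_nhds (s := Ioi 0))
    simpa using this

lemma cpow_ofReal_mul' {c : ℝ} (hc : 0 < c) {w : ℂ} (hw : w ≠ 0) (a : ℝ) :
    ((c : ℂ) * w) ^ (a : ℂ) = ((c ^ a : ℝ) : ℂ) * w ^ (a : ℂ) := by
  have hc' : (c : ℂ) ≠ 0 := by exact_mod_cast hc.ne'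
  rw [cpow_def_of_ne_zero (mul_ne_zero hc' hw), log_ofReal_mul hc hw, add_mul, exp_add,
    ← cpow_def_of_ne_zero hw, ofReal_cpow hc.le, cpow_def_of_ne_zero hc', ofReal_log hc.le]

lemma cpow_negI_mul {w : ℂ} (hw : 0 < w.re) (a : ℂ) :
    (-I * w) ^ a = (-I) ^ a * w ^ a := by
  have hw0 : w ≠ 0 := by rintro rfl; simp at hw
  have hI : -I ≠ 0 := by simp
  have h := abs_lt.1 (abs_arg_lt_pi_div_two_iff.2 (Or.inl hw))
  rw [cpow_def_of_ne_zero (mul_ne_zero hI hw0), cpow_def_of_ne_zero hI, cpow_def_of_ne_zero hw0,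
    (log_mul_eq_add_log_iff hI hw0).2, add_mul, exp_add]
  rw [arg_neg_I]
  constructor <;> linarith [Real.pi_pos]

lemma bf_one (r a : ℝ) (hr : 0 < r) {x : ℝ} (hx : 0 < x) :
    bf r a ((1 : ℝ) + x * I) = (exp (I * r) * (-I) ^ (a : ℂ) * ((2 ^ a * r ^ (-a) : ℝ) : ℂ)) *
      (((Real.exp (-(r * x)) * (r * x) ^ a : ℝ) : ℂ) * (bW (r * x) r) ^ (a : ℂ)) := by
  have hr0 : (r : ℂ) ≠ 0 := by exact_mod_cast hr.ne'
  have hW : bW (r * x) r = 1 + I * x / 2 := by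
    unfold bW; push_cast; field_simp
  have hre : 0 < (1 + I * x / 2 : ℂ).re := by simp
  have hne : (1 + I * x / 2 : ℂ) ≠ 0 := by
    intro h; rw [h] at hre; simp at hre
  have e1 : 1 - (((1 : ℝ) : ℂ) + x * I) ^ 2 = ((2 * x : ℝ) : ℂ) * (-I * (1 + I * x / 2)) := by
    push_cast
    linear_combination (-(x : ℂ) ^ 2 + x ^ 2) * I_sq
  have e2 : exp (I * (((1 : ℝ) : ℂ) + x * I) * r) = exp (I * r) * ((Real.exp (-(r * x)) : ℝ) : ℂ) := by
    rw [ofReal_exp, ← exp_add]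
    congr 1
    push_cast
    linear_combination (r * x : ℂ) * I_sq
  have e3 : (2 * x) ^ a = 2 ^ a * r ^ (-a) * (r * x) ^ a := by
    rw [Real.mul_rpow (by norm_num) hx.le, Real.mul_rpow hr.le hx.le, Real.rpow_neg hr.le]
    have := (Real.rpow_pos_of_pos hr a).ne'
    field_simp
  unfold bf
  rw [hW, e1, e2, cpow_ofReal_mul' (by positivity) (mul_ne_zero (by simp) hne),
    cpow_negI_mul hre, e3]
  push_cast
  ring

lemma bf_neg_one (r a : ℝ) {x : ℝ} (hx : 0 < x) :
    bf r a ((-1 : ℝ) + x * I) = (starRingEnd ℂ) (bf r a ((1 : ℝ) + x * I)) := by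
  have hs : 1 - (((1 : ℝ) : ℂ) + x * I) ^ 2 ∈ slitPlane := sq_slit (by norm_num; positivity)
  unfold bf
  rw [map_mul, ← exp_conj]
  have h := conj_cpow _ (a : ℂ) (slitPlane_arg_ne_pi hs)
  rw [conj_ofReal] at h
  rw [← h]
  congr 2
  · simp; ring
  · simp; ring

lemma contour (r a : ℝ) (hr : 0 < r) (ha : -1 < a) :
    ∃ W : ℂ, W = -I * ((exp (I * r) * (-I) ^ (a : ℂ) * ((2 ^ a * r ^ (-a) : ℝ) : ℂ)) *
      (((r⁻¹ : ℝ) : ℂ) * bF a r)) ∧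
    ∫ s in (-1 : ℝ)..1, bf r a s = W + (starRingEnd ℂ) W := by
  set A : ℂ := exp (I * r) * (-I) ^ (a : ℂ) * ((2 ^ a * r ^ (-a) : ℝ) : ℂ) with hA
  set Φ : ℝ → ℂ := fun t => ((Real.exp (-t) * t ^ a : ℝ) : ℂ) * (bW t r) ^ (a : ℂ) with hΦ
  have hint : IntegrableOn Φ (Ioi 0) := bF_integrable a ha (real_mem_bS hr)
  have hint2 : IntegrableOn (fun x => A * Φ (r * x)) (Ioi 0) := by
    refine Integrable.const_mul ?_ A
    have := (integrableOn_Ioi_comp_mul_left_iff Φ 0 hr).2 (by simpa using hint)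
    exact this
  have hval : ∫ x in Ioi (0 : ℝ), A * Φ (r * x) = A * (((r⁻¹ : ℝ) : ℂ) * bF a r) := by
    rw [integral_const_mul, integral_comp_mul_left_Ioi Φ 0 hr, mul_zero, real_smul]
    rfl
  have hp : EqOn (fun x => A * Φ (r * x)) (fun x : ℝ => bf r a ((1 : ℝ) + x * I)) (Ioi 0) :=
    fun x hx => (bf_one r a hr hx).symm
  have hp1 : IntegrableOn (fun x : ℝ => bf r a ((1 : ℝ) + x * I)) (Ioi 0) :=
    hint2.congr_fun hp measurableSet_Ioi
  have hpv : ∫ x in Ioi (0 : ℝ), bf r a ((1 : ℝ) + x * I) = A * (((r⁻¹ : ℝ) : ℂ) * bF a r) := by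
    rw [← hval]; exact (setIntegral_congr_fun measurableSet_Ioi hp).symm
  have hm : EqOn (fun x : ℝ => (starRingEnd ℂ) (bf r a ((1 : ℝ) + x * I)))
      (fun x : ℝ => bf r a ((-1 : ℝ) + x * I)) (Ioi 0) :=
    fun x hx => (bf_neg_one r a hx).symm
  have hm1 : IntegrableOn (fun x : ℝ => bf r a ((-1 : ℝ) + x * I)) (Ioi 0) :=
    IntegrableOn.congr_fun (conjLIE.toContinuousLinearEquiv.toContinuousLinearMap.integrable_comp hp1)
      hm measurableSet_Ioi
  have hmv : ∫ x in Ioi (0 : ℝ), bf r a ((-1 : ℝ) + x * I) =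
      (starRingEnd ℂ) (A * (((r⁻¹ : ℝ) : ℂ) * bF a r)) := by
    rw [← hpv, ← integral_conj]; exact (setIntegral_congr_fun measurableSet_Ioi hm).symm
  refine ⟨_, rfl, ?_⟩
  have t1 := vert_tendsto hp1
  have t2 := vert_tendsto hm1
  have hH : Tendsto (fun n : ℕ => (n : ℝ) + 1) atTop atTop :=
    tendsto_atTop_add_const_right _ _ tendsto_natCast_atTop_atTop
  have t3 := (top_tendsto (a := a) hr).comp hH
  have hε : Tendsto (fun n : ℕ => 1 / ((n : ℝ) + 1)) atTop (𝓝[>] 0) :=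
    tendsto_nhdsWithin_iff.2 ⟨tendsto_one_div_add_atTop_nhds_zero_nat,
      Eventually.of_forall fun n => by show (0 : ℝ) < _; positivity⟩
  have t4 := (bot_tendsto hr ha).comp hε
  rw [hpv] at t1
  rw [hmv] at t2
  have t5 := ((t4.sub t3).add (t1.const_mul I)).sub (t2.const_mul I)
  have t6 : ∀ n : ℕ, (∫ s in (-1 : ℝ)..1, bf r a (s + ((1 / ((n : ℝ) + 1) : ℝ) : ℂ) * I)) -
      (∫ s in (-1 : ℝ)..1, bf r a (s + (((n : ℝ) + 1 : ℝ) : ℂ) * I)) +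
      I * (∫ x in (1 / ((n : ℝ) + 1))..((n : ℝ) + 1), bf r a ((1 : ℝ) + x * I)) -
      I * (∫ x in (1 / ((n : ℝ) + 1))..((n : ℝ) + 1), bf r a ((-1 : ℝ) + x * I)) = 0 := by
    intro n
    have hn : (0 : ℝ) < (n : ℝ) + 1 := by positivity
    have hn1 : 1 / ((n : ℝ) + 1) ≤ (n : ℝ) + 1 := by
      rw [div_le_iff₀ hn]
      have : (0 : ℝ) ≤ n := n.cast_nonneg
      nlinarith
    have key := integral_boundary_rect_eq_zero_of_differentiableOn (bf r a)
      (⟨-1, 1 / ((n : ℝ) + 1)⟩ : ℂ) (⟨1, (n : ℝ) + 1⟩ : ℂ) ?_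
    · simpa only [smul_eq_mul] using key
    · intro z hz
      rw [mem_reProdIm] at hz
      simp only at hz
      rw [uIcc_of_le (by norm_num), uIcc_of_le hn1] at hz
      have hy : 0 < z.im := lt_of_lt_of_le (by positivity) hz.2.1
      have hd := bf_diff (r := r) (a := a) (s := z.re) (y := z.im)
        (by nlinarith [hz.1.1, hz.1.2, mul_pos hy hy])
      rw [re_add_im] at hd
      exact hd.differentiableWithinAt
  have t7 := tendsto_nhds_unique t5 (tendsto_const_nhds.congr fun n => (t6 n).symm)
  rw [map_mul, map_neg, conj_I]
  linear_combination t7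

/-- The constant in front of the Hankel-type integral. -/
noncomputable def bK (ν : ℝ) : ℂ :=
  ((2 ^ (-(1 : ℝ) / 2) / (Real.Gamma (ν + 1 / 2) * Real.Gamma (1 / 2)) : ℝ) : ℂ) *
    (-I * (-I) ^ ((ν - 1 / 2 : ℝ) : ℂ))

lemma bessel_eq {ν r : ℝ} (hν : 0 < ν) (hr : 0 < r) :
    besselJ ν r = ((r ^ (-(1 : ℝ) / 2) : ℝ) : ℂ) *
      (exp (I * r) * (bK ν * bF (ν - 1 / 2) r) +
        exp (-(I * r)) * (starRingEnd ℂ) (bK ν * bF (ν - 1 / 2) r)) := by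
  obtain ⟨W, hW, hI⟩ := contour r (ν - 1 / 2) hr (by linarith)
  have h1 : ∫ s in (-1 : ℝ)..1, exp (I * s * r) * (((1 - s ^ 2) ^ (ν - 1 / 2) : ℝ) : ℂ) =
      ∫ s in (-1 : ℝ)..1, bf r (ν - 1 / 2) s := by
    refine intervalIntegral.integral_congr fun s hs => ?_
    rw [uIcc_of_le (by norm_num)] at hs
    simp only [bf]
    rw [ofReal_cpow (by nlinarith [hs.1, hs.2])]
    push_cast
    rfl
  set P : ℝ := (r / 2) ^ ν / (Real.Gamma (ν + 1 / 2) * Real.Gamma (1 / 2)) with hP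
  have h2 : (P : ℂ) * W = ((r ^ (-(1 : ℝ) / 2) : ℝ) : ℂ) *
      (exp (I * r) * (bK ν * bF (ν - 1 / 2) r)) := by
    have e : P * (2 ^ (ν - 1 / 2) * r ^ (-(ν - 1 / 2))) * r⁻¹ = r ^ (-(1 : ℝ) / 2) *
        (2 ^ (-(1 : ℝ) / 2) / (Real.Gamma (ν + 1 / 2) * Real.Gamma (1 / 2))) := by
      have e1 : (r / 2) ^ ν * (2 ^ (ν - 1 / 2) * r ^ (-(ν - 1 / 2))) * r⁻¹ =
          r ^ (-(1 : ℝ) / 2) * 2 ^ (-(1 : ℝ) / 2) := by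
        have a1 : (2 : ℝ) ^ (ν - 1 / 2) = 2 ^ ν * 2 ^ (-(1 : ℝ) / 2) := by
          rw [← Real.rpow_add (by norm_num)]; ring_nf
        have a2 : r ^ (-(ν - 1 / 2)) * r⁻¹ = (r ^ ν)⁻¹ * r ^ (-(1 : ℝ) / 2) := by
          rw [← Real.rpow_neg hr.le, ← Real.rpow_neg_one r, ← Real.rpow_add hr, ← Real.rpow_add hr]
          ring_nf
        rw [Real.div_rpow hr.le (by norm_num), a1, mul_assoc, mul_assoc, a2]
        have b1 := (Real.rpow_pos_of_pos hr ν).ne'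
        have b2 : (2 : ℝ) ^ ν ≠ 0 := by positivity
        field_simp
      rw [hP, div_mul_eq_mul_div, div_mul_eq_mul_div, e1, mul_div_assoc]
    have e' := congrArg (fun x : ℝ => (x : ℂ)) e
    simp only [ofReal_mul] at e'
    rw [hW]
    unfold bK
    simp only [ofReal_mul]
    linear_combination (-I * exp (I * r) * (-I) ^ ((ν - 1 / 2 : ℝ) : ℂ) * bF (ν - 1 / 2) r) * e'
  have h3 : (P : ℂ) * (starRingEnd ℂ) W = (starRingEnd ℂ) ((P : ℂ) * W) := by
    rw [map_mul, conj_ofReal]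
  unfold besselJ
  rw [h1, hI, ← hP, mul_add, h3, h2, map_mul, conj_ofReal, map_mul, ← exp_conj, map_mul, conj_I,
    conj_ofReal]
  ring_nf

/-- The holomorphic amplitude. -/
noncomputable def bG (ν : ℝ) (z : ℂ) : ℂ := bK ν * bF (ν - 1 / 2) z

lemma bG_diff {ν : ℝ} (hν : 0 < ν) : DifferentiableOn ℂ (bG ν) bS :=
  (bF_diff (by linarith)).const_mul _

lemma conj_smooth {f : ℝ → ℂ} {s : Set ℝ} (h : ContDiffOn ℝ (⊤ : ℕ∞) f s) :
    ContDiffOn ℝ (⊤ : ℕ∞) (fun r => (starRingEnd ℂ) (f r)) s :=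
  conjLIE.toContinuousLinearEquiv.contDiff.comp_contDiffOn h

lemma conj_iter (f : ℝ → ℂ) (N : ℕ) (r : ℝ) (hr : 1 ≤ r) :
    ‖iteratedDerivWithin N (fun r => (starRingEnd ℂ) (f r)) (Ici 1) r‖ =
      ‖iteratedDerivWithin N f (Ici 1) r‖ := by
  rw [← norm_iteratedFDerivWithin_eq_norm_iteratedDerivWithin,
    ← norm_iteratedFDerivWithin_eq_norm_iteratedDerivWithin]
  exact LinearIsometryEquiv.norm_iteratedFDerivWithin_comp_left conjLIE f (uniqueDiffOn_Ici 1) hr N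

lemma bG_deriv_diff {ν : ℝ} (hν : 0 < ν) : DifferentiableOn ℂ (deriv (bG ν)) bS :=
  (bG_diff hν).deriv bS_open

lemma bG_fixed {ν : ℝ} (hν : 0 < ν) (N : ℕ) : ∃ C : ℝ, 0 < C ∧
    (∀ r : ℝ, 1 ≤ r → ‖bG ν r‖ ≤ C) ∧
    (1 ≤ N → ∀ r : ℝ, 1 ≤ r →
      ‖iteratedDerivWithin N (fun x : ℝ => bG ν x) (Ici 1) r‖ ≤ C * r ^ (-(N : ℝ) - 1)) := by
  have ha : -1 < ν - 1 / 2 := by linarith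
  obtain ⟨C0, hC0, h0⟩ := bF_norm_le (ν - 1 / 2) ha one_pos
  obtain ⟨C1, hC1, h1⟩ := bF_deriv_bound ha (m := 3 / 4) (by norm_num)
  have hk : 0 ≤ ‖bK ν‖ := norm_nonneg _
  set D : ℝ := (N - 1).factorial * 4 ^ (N - 1) * (‖bK ν‖ * (C1 * 16 / 9)) with hD
  have hD0 : 0 ≤ D := by positivity
  refine ⟨‖bK ν‖ * C0 + D + 1, by positivity, fun r hr => ?_, fun hN r hr => ?_⟩
  · have hz := h0 r (real_mem_bS (by linarith))
      (by rw [norm_real, Real.norm_of_nonneg (by linarith)]; exact hr)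
    unfold bG
    rw [norm_mul]
    have : ‖bK ν‖ * ‖bF (ν - 1 / 2) r‖ ≤ ‖bK ν‖ * C0 := mul_le_mul_of_nonneg_left hz hk
    linarith
  · obtain ⟨n, rfl⟩ : ∃ n, N = n + 1 := ⟨N - 1, by omega⟩
    have hr0 : 0 < r := by linarith
    rw [iter_eq (bG_diff hν) _ r hr, iteratedDeriv_succ']
    have key := cauchy_est (bG_deriv_diff hν) n (r := r)
      (C := ‖bK ν‖ * (C1 * 16 / 9) / r ^ 2) hr0 ?_
    · refine key.trans ?_
      have e : r ^ (-((n + 1 : ℕ) : ℝ) - 1) = (r ^ n)⁻¹ * (r ^ 2)⁻¹ := by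
        rw [show (-((n + 1 : ℕ) : ℝ) - 1) = -((n + 2 : ℕ) : ℝ) by push_cast; ring,
          Real.rpow_neg hr0.le, Real.rpow_natCast, pow_add, mul_inv]
      rw [e]
      simp only [Nat.add_sub_cancel] at hD
      have e2 : n.factorial * 4 ^ n * (‖bK ν‖ * (C1 * 16 / 9) / r ^ 2) / r ^ n =
          D * ((r ^ n)⁻¹ * (r ^ 2)⁻¹) := by
        rw [hD]; field_simp
      rw [e2]
      gcongr
      have : 0 ≤ ‖bK ν‖ * C0 := by positivity
      linarith
    · intro z hz hzr
      have hd : deriv (bG ν) z = bK ν * deriv (bF (ν - 1 / 2)) z :=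
        ((bF_hasDerivAt ha hz).differentiableAt.hasDerivAt.const_mul (bK ν)).deriv
      rw [hd, norm_mul, mul_div_assoc]
      refine mul_le_mul_of_nonneg_left ?_ hk
      refine (h1 z hz (by linarith)).trans ?_
      calc C1 / ‖z‖ ^ 2 ≤ C1 / (3 / 4 * r) ^ 2 := by gcongr
        _ = _ := by field_simp; norm_num

lemma bK_norm {ν : ℝ} (hν : 0 < ν) : ‖bK ν‖ =
    2 ^ (-(1 : ℝ) / 2) / (Real.Gamma (ν + 1 / 2) * Real.Gamma (1 / 2)) := by
  have h1 : 0 < Real.Gamma (ν + 1 / 2) := Real.Gamma_pos_of_pos (by linarith)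
  have h2 : 0 < Real.Gamma (1 / 2) := Real.Gamma_pos_of_pos (by norm_num)
  unfold bK
  rw [norm_mul, norm_mul, norm_cpow_real, norm_neg, norm_I, Real.one_rpow, norm_real,
    Real.norm_of_nonneg (by positivity)]
  ring

lemma bG_unif (N : ℕ) : ∃ C : ℝ, 0 < C ∧ ∀ ν r : ℝ, 1 ≤ 2 * ν → 2 * ν ≤ r →
    ‖iteratedDerivWithin N (fun x : ℝ => bG ν x) (Ici 1) r‖ ≤ C * 2 ^ ν * (ν / r) ^ N := by
  have hg2 : 0 < Real.Gamma (1 / 2) := Real.Gamma_pos_of_pos (by norm_num)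
  refine ⟨N.factorial * 4 ^ N * 2 ^ N / Real.Gamma (1 / 2), by positivity, fun ν r hν hr => ?_⟩
  have hν0 : 0 < ν := by linarith
  have hr0 : 0 < r := by linarith
  have hg1 : 0 < Real.Gamma (ν + 1 / 2) := Real.Gamma_pos_of_pos (by linarith)
  rw [iter_eq (bG_diff hν0) _ r (by show 1 ≤ r; linarith)]
  have key := cauchy_est (bG_diff hν0) N (r := r) (C := 2 ^ ν / Real.Gamma (1 / 2)) hr0 ?_
  · refine key.trans ?_
    have h1 : (1 : ℝ) ≤ (2 * ν) ^ N := one_le_pow₀ hν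
    calc N.factorial * 4 ^ N * (2 ^ ν / Real.Gamma (1 / 2)) / r ^ N
        = (N.factorial * 4 ^ N * (2 ^ ν / Real.Gamma (1 / 2)) / r ^ N) * 1 := by ring
      _ ≤ (N.factorial * 4 ^ N * (2 ^ ν / Real.Gamma (1 / 2)) / r ^ N) * (2 * ν) ^ N := by gcongr
      _ = _ := by rw [mul_pow, div_pow]; ring
  · intro z _ hzr
    have h := bF_uniform hν (z := z) (by linarith)
    unfold bG
    rw [norm_mul, bK_norm hν0]
    calc _ ≤ 2 ^ (-(1 : ℝ) / 2) / (Real.Gamma (ν + 1 / 2) * Real.Gamma (1 / 2)) *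
          (Real.Gamma (ν + 1 / 2) * (3 / 2) ^ (ν + 1 / 2)) := by gcongr
      _ = 2 ^ (-(1 : ℝ) / 2) * (3 / 2) ^ (ν + 1 / 2) / Real.Gamma (1 / 2) := by field_simp
      _ ≤ 2 ^ (-(1 : ℝ) / 2) * 2 ^ (ν + 1 / 2) / Real.Gamma (1 / 2) := by
          gcongr
          norm_num
      _ = 2 ^ ν / Real.Gamma (1 / 2) := by
          rw [← Real.rpow_add (by norm_num)]; ring_nf

end BesselAux

/-- There are functions `j₊, j₋ : (0,∞) × [1,∞) → ℂ`, smooth in `r`, such that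
(i) `J_ν(r) = r^{-1/2}(e^{ir} j₊(ν,r) + e^{-ir} j₋(ν,r))` for `ν > 0`, `r ≥ 1`;
(ii) for fixed `ν > 0` and `N ∈ ℕ` there is `C_{ν,N}` with
`|j_±(ν,r)| ≤ C_{ν,0}` and `|(∂/∂r)^N j_±(ν,r)| ≤ C_{ν,N} r^{-N-1}` for `N ≥ 1`, `r ≥ 1`;
(iii) for every `N` there is `C_N` independent of `ν` with
`|(∂/∂r)^N j_±(ν,r)| ≤ C_N 2^ν (ν/r)^N` whenever `r ≥ 2ν` and `2ν ≥ 1`. -/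
theorem besselJ_oscillatory_decomposition_uniform :
    ∃ jp jm : ℝ → ℝ → ℂ,
      (∀ ν : ℝ, 0 < ν →
        ContDiffOn ℝ (⊤ : ℕ∞) (jp ν) (Set.Ici 1) ∧ ContDiffOn ℝ (⊤ : ℕ∞) (jm ν) (Set.Ici 1)) ∧
      (∀ ν : ℝ, 0 < ν → ∀ r : ℝ, 1 ≤ r →
        besselJ ν r = ((r ^ (-(1 : ℝ) / 2) : ℝ) : ℂ) *
          (Complex.exp (Complex.I * (r : ℂ)) * jp ν r +
            Complex.exp (-(Complex.I * (r : ℂ))) * jm ν r)) ∧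
      (∀ ν : ℝ, 0 < ν → ∀ N : ℕ, ∃ C : ℝ, 0 < C ∧ ∀ r : ℝ, 1 ≤ r →
        (N = 0 → ‖jp ν r‖ ≤ C ∧ ‖jm ν r‖ ≤ C) ∧
        (1 ≤ N →
          ‖iteratedDerivWithin N (jp ν) (Set.Ici 1) r‖ ≤ C * r ^ (-(N : ℝ) - 1) ∧
          ‖iteratedDerivWithin N (jm ν) (Set.Ici 1) r‖ ≤ C * r ^ (-(N : ℝ) - 1))) ∧
      (∀ N : ℕ, ∃ C : ℝ, 0 < C ∧ ∀ ν r : ℝ, 1 ≤ 2 * ν → 2 * ν ≤ r →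
        ‖iteratedDerivWithin N (jp ν) (Set.Ici 1) r‖ ≤ C * 2 ^ ν * (ν / r) ^ N ∧
        ‖iteratedDerivWithin N (jm ν) (Set.Ici 1) r‖ ≤ C * 2 ^ ν * (ν / r) ^ N) := by
  refine ⟨fun ν r => BesselAux.bG ν r, fun ν r => (starRingEnd ℂ) (BesselAux.bG ν r), ?_, ?_, ?_, ?_⟩
  · intro ν hν
    have h := BesselAux.smooth (BesselAux.bG_diff hν)
    exact ⟨h, BesselAux.conj_smooth h⟩
  · intro ν hν r hr
    exact BesselAux.bessel_eq hν (by linarith)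
  · intro ν hν N
    obtain ⟨C, hC, h0, h1⟩ := BesselAux.bG_fixed hν N
    refine ⟨C, hC, fun r hr => ⟨fun hN => ?_, fun hN => ?_⟩⟩
    · have := h0 r hr
      exact ⟨this, by rw [RCLike.norm_conj]; exact this⟩
    · have := h1 hN r hr
      exact ⟨this, by rw [BesselAux.conj_iter _ N r hr]; exact this⟩
  · intro N
    obtain ⟨C, hC, h⟩ := BesselAux.bG_unif N
    refine ⟨C, hC, fun ν r hν hr => ?_⟩
    have := h ν r hν hr
    exact ⟨this, by rw [BesselAux.conj_iter _ N r (by linarith)]; exact this⟩
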